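/- Let 𝒜 be a minimally self-adjusting BST algorithm and suppose there are constants ε>0, c>0 and d>0 such that for every access with search path P and after-tree A: (i) every node x∈P loses at least (1/2+ε)·d(x) − c ancestors, where d(x) is the number of ancestors of x on P, and a node y∈P is a lost ancestor of x if y is an ancestor of x on P but not an ancestor of x in A; and (ii) every node y∈P other than the accessed element gains at most d new descendants, where x∈P is a gained descendant of y if x is a descendant of y in A but was not a descendant of y on P (only nodes of P are counted). Then 𝒜 satisfies the access lemma via the SOL potential. -/

import Mathlib

namespace Paper

inductive BTree where
  | nil : BTree
  | node : BTree → ℕ → BTree → BTree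
deriving DecidableEq

namespace BTree

def keys : BTree → Finset ℕ
  | nil => ∅
  | node l x r => insert x (keys l ∪ keys r)

def root? : BTree → Option ℕ
  | nil => none
  | node _ x _ => some x

def isBST : BTree → Prop
  | nil => True
  | node l x r => (∀ y ∈ keys l, y < x) ∧ (∀ y ∈ keys r, x < y) ∧ isBST l ∧ isBST r

def subtree? (s : ℕ) : BTree → Option BTree
  | nil => none
  | node l x r => if s = x then some (node l x r) else if s < x then subtree? s l else subtree? s r

/-- The set of keys of the subtree rooted at `s` (∅ if `s` is not in the tree). -/
def subtreeKeys (T : BTree) (s : ℕ) : Finset ℕ := ((subtree? s T).map keys).getD ∅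

/-- The search path to `s`, listed from the root downwards. -/
def pathList (s : ℕ) : BTree → List ℕ
  | nil => []
  | node l x r => if s = x then [x] else if s < x then x :: pathList s l else x :: pathList s r

def pathSet (T : BTree) (s : ℕ) : Finset ℕ := (pathList s T).toFinset

def nodeDepth (s : ℕ) : BTree → ℕ
  | nil => 0
  | node l x r => if s = x then 0 else if s < x then nodeDepth s l + 1 else nodeDepth s r + 1

/-- Number of right-going edges on the path from the root to `s`. -/
def rightDepth (s : ℕ) : BTree → ℕ
  | nil => 0
  | node l x r => if s = x then 0 else if s < x then rightDepth s l else rightDepth s r + 1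

/-- Number of left-going edges on the path from the root to `s`. -/
def leftDepth (s : ℕ) : BTree → ℕ
  | nil => 0
  | node l x r => if s = x then 0 else if s < x then leftDepth s l + 1 else leftDepth s r

def leafCount : BTree → ℕ
  | nil => 0
  | node nil _ nil => 1
  | node l _ r => leafCount l + leafCount r

/-- The wing partition of a BST, each wing listed from its topmost node downwards. -/
def wings : BTree → List (List ℕ)
  | nil => []
  | node l x r =>
    match wings l with
    | [] => [x] :: wings r
    | wl :: rest => (x :: wl) :: (rest ++ wings r)

end BTree

open BTree

/-- The left-leaning path on `[n]`: `n` at the root, `1` at the deepest node. -/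
def leftPathTree : ℕ → BTree
  | 0 => BTree.nil
  | n + 1 => BTree.node (leftPathTree n) (n + 1) BTree.nil

/-- Number of side alternations (w.r.t. `s`) between adjacent elements of a list. -/
def sideAlt (s : ℕ) : List ℕ → ℕ
  | x :: y :: rest => (if (x < s ∧ s < y) ∨ (y < s ∧ s < x) then 1 else 0) + sideAlt s (y :: rest)
  | _ => 0

/-- The set of elements involved in side alternations (w.r.t. `s`) in a list. -/
def zigzagSet (s : ℕ) : List ℕ → Finset ℕ
  | x :: y :: rest =>
    (if (x < s ∧ s < y) ∨ (y < s ∧ s < x) then ({x, y} : Finset ℕ) else ∅) ∪ zigzagSet s (y :: rest)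
  | _ => ∅

noncomputable def wsum (w : ℕ → ℝ) (X : Finset ℕ) : ℝ := ∑ b ∈ X, w b

/-- Partial sum-of-logs potential of the set `X` in tree `T` (binary logarithm). -/
noncomputable def phiOn (w : ℕ → ℝ) (T : BTree) (X : Finset ℕ) : ℝ :=
  ∑ a ∈ X, Real.logb 2 (wsum w (subtreeKeys T a))

noncomputable def phiAll (w : ℕ → ℝ) (T : BTree) : ℝ := phiOn w T (keys T)

/-- A single access of a minimally self-adjusting BST algorithm: the accessed element `s`
becomes the root, the keys are unchanged, and every node off the search path keeps its
subtree; hence the search path is replaced by an after-tree rooted at `s` and the pendent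
subtrees are reattached in the unique order-preserving way. -/
structure IsAccess (T : BTree) (s : ℕ) (T' : BTree) : Prop where
  hT : isBST T
  hT' : isBST T'
  hs : s ∈ keys T
  hkeys : keys T' = keys T
  hroot : root? T' = some s
  hpendent : ∀ a ∈ keys T, a ∉ pathSet T s → subtree? a T' = subtree? a T

/-- The algorithm (viewed as the set of accesses it may perform) satisfies the access lemma
via the sum-of-logs potential. -/
def SatisfiesAL (Alg : BTree → ℕ → BTree → Prop) : Prop :=
  ∃ C : ℝ, 0 ≤ C ∧ ∀ T s T', Alg T s T' → ∀ w : ℕ → ℝ, (∀ i ∈ keys T, 0 < w i) →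
    ((pathSet T s).card : ℝ) ≤
      phiAll w T - phiAll w T' + C * (1 + Real.logb 2 (wsum w (keys T) / w s))

/-- `X` is subtree-disjoint (w.r.t. the tree after the access). -/
def SubtreeDisjoint (T' : BTree) (X : Finset ℕ) : Prop :=
  ∀ a ∈ X, ∀ b ∈ X, a ≠ b → subtreeKeys T' a ∩ subtreeKeys T' b = ∅

/-- `X` is monotone: all elements on one side of `s`, with equal right-depth
(resp. left-depth) in the after-tree.  (For nodes of the search path, depth in the
after-tree coincides with depth in `T'`.) -/
def IsMonotone (s : ℕ) (T' : BTree) (X : Finset ℕ) : Prop :=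
  ((∀ x ∈ X, s < x) ∧ ∃ d, ∀ x ∈ X, rightDepth x T' = d) ∨
  ((∀ x ∈ X, x < s) ∧ ∃ d, ∀ x ∈ X, leftDepth x T' = d)

/-- The after-tree minus its root can be partitioned into (at most) `k` monotone sets. -/
def MonotoneDecomp (T : BTree) (s : ℕ) (T' : BTree) (k : ℕ) : Prop :=
  ∃ M : Fin k → Finset ℕ,
    (∀ i, IsMonotone s T' (M i)) ∧
    (∀ i j, i ≠ j → Disjoint (M i) (M j)) ∧
    Finset.univ.biUnion M = pathSet T s \ {s}

/-- The leaves of the after-tree: path nodes having no path node as proper descendant in `T'`. -/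
def afterLeaves (T : BTree) (s : ℕ) (T' : BTree) : Finset ℕ :=
  (pathSet T s).filter (fun x => subtreeKeys T' x ∩ pathSet T s = {x})

/-- Rotate-to-root: `s` becomes the root and ancestor relations are otherwise preserved,
equivalently `T'(a) = T(a) ∩ (-∞,s)` for path nodes `a < s` and symmetrically for `a > s`. -/
def IsRotateToRoot (T : BTree) (s : ℕ) (T' : BTree) : Prop :=
  subtreeKeys T' s = keys T ∧
  ∀ a ∈ pathSet T s,
    (a < s → subtreeKeys T' a = (subtreeKeys T a).filter (fun b => b < s)) ∧
    (s < a → subtreeKeys T' a = (subtreeKeys T a).filter (fun b => s < b))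

def pendTree : Option ℕ → BTree
  | none => BTree.nil
  | some u => BTree.node BTree.nil u BTree.nil

def buildLeft (l : List (ℕ × Option ℕ)) : BTree :=
  l.foldl (fun t vc => BTree.node (pendTree vc.2) vc.1 t) BTree.nil

def buildRight (l : List (ℕ × Option ℕ)) : BTree :=
  l.foldl (fun t vc => BTree.node t vc.1 (pendTree vc.2)) BTree.nil

/-- Global view of splay: process the reversed search path `v₁, v₂, …` in pairs; if a pair
lies on the same side of `s`, the more ancestral element is removed from its path and
becomes a (pendant) child of the other.  Returns the two spines (elements `< s` and `> s`),
deepest first, each spine node with its optional pendant child. -/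
def splaySpines (s : ℕ) : List ℕ → List (ℕ × Option ℕ) × List (ℕ × Option ℕ)
  | [] => ([], [])
  | [v] => if v < s then ([(v, none)], []) else ([], [(v, none)])
  | v :: u :: rest =>
    let p := splaySpines s rest
    if v < s then
      if u < s then ((v, some u) :: p.1, p.2)
      else ((v, none) :: p.1, (u, none) :: p.2)
    else
      if u < s then ((u, none) :: p.1, (v, none) :: p.2)
      else (p.1, (v, some u) :: p.2)

/-- The after-tree of a splay access, built from the reversed search path without `s`. -/
def splayAfterTree (s : ℕ) (l : List ℕ) : BTree :=
  BTree.node (buildLeft (splaySpines s l).1) s (buildRight (splaySpines s l).2)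

/-- A splay access: a valid access whose after-tree (the restriction of `T'` to the search
path) is the splay after-tree. -/
def IsSplayAccess (T : BTree) (s : ℕ) (T' : BTree) : Prop :=
  IsAccess T s T' ∧
  ∀ x ∈ pathSet T s,
    subtreeKeys T' x ∩ pathSet T s = subtreeKeys (splayAfterTree s (pathList s T).reverse.tail) x

/-- A path-balance access: a valid access whose after-tree is a balanced BST of depth
`⌈log₂ (1 + |P|)⌉` rooted at `s`. -/
def IsPathBalanceAccess (T : BTree) (s : ℕ) (T' : BTree) : Prop :=
  IsAccess T s T' ∧
  ∀ x ∈ pathSet T s, nodeDepth x T' ≤ Nat.clog 2 (1 + (pathSet T s).card)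

def isParent (Q : BTree) (x y : ℕ) : Prop := pathList y Q = pathList x Q ++ [y]

/-- One step of a decomposition: a (descending) path `Pi` of `Q` is rearranged into a tree,
all other nodes keeping their subtrees. -/
def StepRel (Q Q' : BTree) (Pi : Finset ℕ) : Prop :=
  isBST Q' ∧ keys Q' = keys Q ∧
  (∃ l : List ℕ, l ≠ [] ∧ List.Chain' (isParent Q) l ∧ l.toFinset = Pi) ∧
  (∀ a ∈ keys Q, a ∉ Pi → subtree? a Q' = subtree? a Q)

/-- The transformation of the before-path `P0` (as a tree) into the after-tree `A` admits a
local decomposition with window size `wdw`. -/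
def HasLocalDecomp (s : ℕ) (P0 A : BTree) (wdw : ℕ) : Prop :=
  ∃ (k : ℕ) (Q : ℕ → BTree) (Ps : ℕ → Finset ℕ),
    1 ≤ k ∧ Q 0 = P0 ∧ Q k = A ∧
    (∀ i < k, StepRel (Q i) (Q (i + 1)) (Ps i)) ∧
    s ∈ Ps 0 ∧
    (∀ i, i + 1 < k → (Ps (i + 1) \ Ps i).Nonempty) ∧
    (∀ i, i + 1 < k → (Ps (i + 1) ∩ Ps i).Nonempty) ∧
    (∀ i j, i + 1 < j → j < k → Disjoint (Ps i \ Ps (i + 1)) (Ps j)) ∧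
    (∀ i < k, (Ps i).card ≤ wdw)

/-- The search path to `s` in `T`, as a tree (the before-path of the transformation). -/
def pathTree (s : ℕ) : BTree → BTree
  | BTree.nil => BTree.nil
  | BTree.node l x r =>
    if s = x then BTree.node BTree.nil x BTree.nil
    else if s < x then BTree.node (pathTree s l) x BTree.nil
    else BTree.node BTree.nil x (pathTree s r)

/-- `A` is the after-tree of the access `(T, s, T')`: the restriction of `T'` to the search path. -/
def IsAfterTree (T : BTree) (s : ℕ) (T' A : BTree) : Prop :=
  isBST A ∧ keys A = pathSet T s ∧
  ∀ x ∈ pathSet T s, subtreeKeys A x = subtreeKeys T' x ∩ pathSet T s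

/-- The algorithm is local with window size `wdw`. -/
def IsLocal (Alg : BTree → ℕ → BTree → Prop) (wdw : ℕ) : Prop :=
  ∀ T s T', Alg T s T' → ∀ A, IsAfterTree T s T' A → HasLocalDecomp s (pathTree s T) A wdw

open scoped Classical in
noncomputable def stair (n : ℕ) (h : ℕ → ℕ) (s : ℕ) : Finset ℕ :=
  (Finset.Icc 1 n).filter
    (fun b => ∀ b' ∈ Finset.Icc 1 n, ((s < b' ∧ b' < b) ∨ (b < b' ∧ b' < s)) → h b' < h b)

open scoped Classical in
noncomputable def nbhd (n : ℕ) (h : ℕ → ℕ) (a : ℕ) : Finset ℕ :=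
  (Finset.Icc 1 n).filter
    (fun b => ∀ b' ∈ Finset.Icc 1 n, b' ≠ a → min a b ≤ b' → b' ≤ max a b → h b' < h a)

/-- Geometric sum-of-logs partial potential. -/
noncomputable def phiGeo (n : ℕ) (h : ℕ → ℕ) (w : ℕ → ℝ) (X : Finset ℕ) : ℝ :=
  ∑ a ∈ X, Real.logb 2 (wsum w (nbhd n h a))

/-- `l` is (the reversal of) a valid search path to `s`, without `s`, deepest element first. -/
def ValidRevPath (s : ℕ) (l : List ℕ) : Prop :=
  l.Nodup ∧ s ∉ l ∧
  l.Pairwise (fun a b => (a < s → b < s → b < a) ∧ (s < a → s < b → a < b))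

end Paper

open Paper Paper.BTree
namespace Paper

namespace BTree

lemma subtreeKeys_nil (y : ℕ) : subtreeKeys nil y = ∅ := by
  simp [subtreeKeys, subtree?]

lemma subtreeKeys_node (l r : BTree) (x y : ℕ) :
    subtreeKeys (node l x r) y =
      if y = x then keys (node l x r) else if y < x then subtreeKeys l y else subtreeKeys r y := by
  unfold subtreeKeys
  rw [subtree?]
  split_ifs <;> simp

lemma mem_keys_node {l r : BTree} {x y : ℕ} :
    y ∈ keys (node l x r) ↔ y = x ∨ y ∈ keys l ∨ y ∈ keys r := by
  simp [keys]

lemma subtreeKeys_subset_keys (T : BTree) (y : ℕ) : subtreeKeys T y ⊆ keys T := by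
  induction T with
  | nil => simp [subtreeKeys_nil]
  | node l x r ihl ihr =>
    intro z hz
    rw [subtreeKeys_node] at hz
    rw [mem_keys_node]
    split_ifs at hz
    · rwa [mem_keys_node] at hz
    · exact Or.inr (Or.inl (ihl hz))
    · exact Or.inr (Or.inr (ihr hz))

lemma mem_keys_of_mem_subtreeKeys {T : BTree} {y z : ℕ} (h : z ∈ subtreeKeys T y) :
    y ∈ keys T := by
  induction T with
  | nil => simp [subtreeKeys_nil] at h
  | node l x r ihl ihr =>
    rw [subtreeKeys_node] at h
    rw [mem_keys_node]
    split_ifs at h with h1 h2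
    · exact Or.inl h1
    · exact Or.inr (Or.inl (ihl h))
    · exact Or.inr (Or.inr (ihr h))

lemma self_mem_subtreeKeys {T : BTree} (hT : isBST T) {y : ℕ} (hy : y ∈ keys T) :
    y ∈ subtreeKeys T y := by
  induction T with
  | nil => simp [keys] at hy
  | node l x r ihl ihr =>
    obtain ⟨hl, hr, hbl, hbr⟩ := hT
    rw [subtreeKeys_node]
    rw [mem_keys_node] at hy
    split_ifs with h1 h2
    · rwa [mem_keys_node]
    · refine ihl hbl ?_
      rcases hy with h | h | h
      · omega
      · exact h
      · have := hr y h
        omega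
    · refine ihr hbr ?_
      rcases hy with h | h | h
      · omega
      · have := hl y h
        omega
      · exact h

lemma mem_pathSet_iff {T : BTree} (hT : isBST T) {x y : ℕ} (hx : x ∈ keys T) :
    y ∈ pathSet T x ↔ x ∈ subtreeKeys T y := by
  induction T with
  | nil => simp [keys] at hx
  | node l a r ihl ihr =>
    obtain ⟨hl, hr, hbl, hbr⟩ := hT
    have hx' := hx
    rw [mem_keys_node] at hx
    have hyl : x ∈ subtreeKeys l y → x < a ∧ y < a := fun h =>
      ⟨hl _ (subtreeKeys_subset_keys _ _ h), hl _ (mem_keys_of_mem_subtreeKeys h)⟩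
    have hyr : x ∈ subtreeKeys r y → a < x ∧ a < y := fun h =>
      ⟨hr _ (subtreeKeys_subset_keys _ _ h), hr _ (mem_keys_of_mem_subtreeKeys h)⟩
    have hxl := hl x
    have hxr := hr x
    rw [subtreeKeys_node]
    unfold pathSet at *
    rw [pathList]
    by_cases h1 : x = a
    · subst h1
      by_cases h3 : y = x
      · simp [h3, hx']
      · simp only [if_true, h3, if_false, List.toFinset_cons, List.toFinset_nil]
        split_ifs <;> grind
    · by_cases h2 : x < a
      · have hk : x ∈ keys l := by grind
        have ih := ihl hbl hk
        simp only [h1, h2, if_true, if_false, List.toFinset_cons, Finset.mem_insert, ih]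
        by_cases h3 : y = a
        · simp [h3, hx']
        · simp only [h3, if_false, false_or]
          split_ifs <;> grind
      · have hk : x ∈ keys r := by grind
        have ih := ihr hbr hk
        simp only [h1, h2, if_false, List.toFinset_cons, Finset.mem_insert, ih]
        by_cases h3 : y = a
        · simp [h3, hx']
        · simp only [h3, if_false, false_or]
          split_ifs <;> grind

lemma subtreeKeys_convex {T : BTree} (hT : isBST T) {p q z y : ℕ}
    (hp : p ∈ subtreeKeys T y) (hq : q ∈ subtreeKeys T y) (hz : z ∈ keys T)
    (hpz : p ≤ z) (hzq : z ≤ q) : z ∈ subtreeKeys T y := by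
  induction T with
  | nil => simp [keys] at hz
  | node l a r ihl ihr =>
    obtain ⟨hl, hr, hbl, hbr⟩ := hT
    rw [subtreeKeys_node] at *
    have hz' := hz
    rw [mem_keys_node] at hz'
    split_ifs at * with h1 h2
    · exact hz
    · have := hl _ (subtreeKeys_subset_keys _ _ hq)
      have := hr z
      exact ihl hbl hp hq (by grind)
    · have := hr _ (subtreeKeys_subset_keys _ _ hp)
      have := hl z
      exact ihr hbr hp hq (by grind)

lemma subtreeKeys_subset_of_mem {T : BTree} (hT : isBST T) {u v : ℕ}
    (h : u ∈ subtreeKeys T v) : subtreeKeys T u ⊆ subtreeKeys T v := by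
  induction T with
  | nil => simp [subtreeKeys_nil]
  | node l a r ihl ihr =>
    obtain ⟨hl, hr, hbl, hbr⟩ := hT
    by_cases h1 : v = a
    · subst h1
      rw [subtreeKeys_node (y := v)]
      simp only [if_true]
      exact subtreeKeys_subset_keys _ _
    · by_cases h2 : v < a
      · simp only [subtreeKeys_node l r a v, h1, h2, if_true, if_false] at h ⊢
        have := hl _ (subtreeKeys_subset_keys _ _ h)
        simp only [subtreeKeys_node l r a u, this.ne, this, if_true, if_false]
        exact ihl hbl h
      · simp only [subtreeKeys_node l r a v, h1, h2, if_false] at h ⊢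
        have := hr _ (subtreeKeys_subset_keys _ _ h)
        simp only [subtreeKeys_node l r a u, this.ne', this.not_gt, if_false]
        exact ihr hbr h

lemma eq_of_mem_subtreeKeys {T : BTree} (hT : isBST T) {u v : ℕ}
    (huv : u ∈ subtreeKeys T v) (hvu : v ∈ subtreeKeys T u) : u = v := by
  induction T with
  | nil => simp [subtreeKeys_nil] at huv
  | node l a r ihl ihr =>
    obtain ⟨hl, hr, hbl, hbr⟩ := hT
    have aux : ∀ {p q : ℕ}, p ∈ subtreeKeys l q → p < a := fun h =>
      hl _ (subtreeKeys_subset_keys _ _ h)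
    have aux' : ∀ {p q : ℕ}, p ∈ subtreeKeys r q → a < p := fun h =>
      hr _ (subtreeKeys_subset_keys _ _ h)
    rw [subtreeKeys_node] at huv hvu
    grind

lemma mem_subtreeKeys_or {T : BTree} (hT : isBST T) {z u v : ℕ}
    (hu : z ∈ subtreeKeys T u) (hv : z ∈ subtreeKeys T v) :
    u ∈ subtreeKeys T v ∨ v ∈ subtreeKeys T u := by
  have hku := mem_keys_of_mem_subtreeKeys hu
  have hkv := mem_keys_of_mem_subtreeKeys hv
  induction T with
  | nil => simp [subtreeKeys_nil] at hu
  | node l a r ihl ihr =>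
    obtain ⟨hl, hr, hbl, hbr⟩ := hT
    have aux : ∀ {p q : ℕ}, p ∈ subtreeKeys l q → p < a := fun h =>
      hl _ (subtreeKeys_subset_keys _ _ h)
    have aux' : ∀ {p q : ℕ}, p ∈ subtreeKeys r q → a < p := fun h =>
      hr _ (subtreeKeys_subset_keys _ _ h)
    have memL : ∀ {p q : ℕ}, p ∈ subtreeKeys l q → q ∈ keys l := mem_keys_of_mem_subtreeKeys
    have memR : ∀ {p q : ℕ}, p ∈ subtreeKeys r q → q ∈ keys r := mem_keys_of_mem_subtreeKeys
    simp only [subtreeKeys_node] at hu hv ⊢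
    grind

lemma exists_common_ancestor {T : BTree} (hT : isBST T) {x y : ℕ} (hx : x ∈ keys T)
    (hy : y ∈ keys T) (hxy : x ≤ y) :
    ∃ u, x ≤ u ∧ u ≤ y ∧ x ∈ subtreeKeys T u ∧ y ∈ subtreeKeys T u := by
  induction T with
  | nil => simp [keys] at hx
  | node l a r ihl ihr =>
    obtain ⟨hl, hr, hbl, hbr⟩ := hT
    by_cases h : x ≤ a ∧ a ≤ y
    · exact ⟨a, h.1, h.2, by simpa [subtreeKeys_node] using hx,
        by simpa [subtreeKeys_node] using hy⟩
    · rw [mem_keys_node] at hx hy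
      have := hl x
      have := hl y
      have := hr x
      have := hr y
      by_cases hxa : x < a
      · obtain ⟨u, h1, h2, h3, h4⟩ := ihl hbl (by grind) (by grind)
        refine ⟨u, h1, h2, ?_⟩
        rw [subtreeKeys_node]
        grind
      · obtain ⟨u, h1, h2, h3, h4⟩ := ihr hbr (by grind) (by grind)
        refine ⟨u, h1, h2, ?_⟩
        rw [subtreeKeys_node]
        grind

lemma subtreeKeys_of_root {T : BTree} {s : ℕ} (h : root? T = some s) :
    subtreeKeys T s = keys T := by
  cases T with
  | nil => simp [root?] at h
  | node l a r =>
    simp only [root?, Option.some.injEq] at h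
    simp [subtreeKeys_node, h]

end BTree

/-- Total gain of a family in which the old set of each element dominates the new set of every
later element. -/
lemma sum_logb_sub_ge_of_chain {φ : ℕ → ℤ} (hφ : Function.Injective φ) {S a : ℕ → ℝ} {v : ℝ}
    (hv : 0 < v) (X : Finset ℕ) :
    ∀ W : ℝ, v ≤ W → (∀ x ∈ X, 0 < a x) → (∀ x ∈ X, a x ≤ W) → (∀ x ∈ X, v ≤ S x) →
      (∀ x ∈ X, ∀ y ∈ X, φ x < φ y → a y ≤ S x) →
      Real.logb 2 v - Real.logb 2 W ≤ ∑ x ∈ X, (Real.logb 2 (S x) - Real.logb 2 (a x)) := by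
  induction X using Finset.induction_on_min_value φ with
  | empty =>
    intro W hW _ _ _ _
    have := Real.logb_le_logb_of_le (b := 2) (by norm_num) hv hW
    simp only [Finset.sum_empty]
    linarith
  | insert x X hx hmin ih =>
    intro W hW ha haW hS hch
    have hlt : ∀ y ∈ X, φ x < φ y := fun y hy =>
      lt_of_le_of_ne (hmin y hy) fun h => hx (hφ h ▸ hy)
    have h1 := ih (S x) (hS x (by simp)) (fun y hy => ha y (by simp [hy]))
      (fun y hy => hch x (by simp) y (by simp [hy]) (hlt y hy))
      (fun y hy => hS y (by simp [hy]))
      (fun y hy z hz => hch y (by simp [hy]) z (by simp [hz]))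
    rw [Finset.sum_insert hx]
    have := Real.logb_le_logb_of_le (b := 2) (by norm_num) (ha x (by simp)) (haW x (by simp))
    linarith

/-- Total gain of a family whose new sets are disjoint and each old set contains all later
new sets. -/
lemma sum_logb_sub_ge_of_disjoint {φ : ℕ → ℤ} (hφ : Function.Injective φ) {S a : ℕ → ℝ}
    {v M K : ℝ} (hv : 0 < v)
    (hK : ∀ R t : ℝ, 0 < R → 0 < t →
      M ≤ Real.logb 2 R - Real.logb 2 t + K * (Real.logb 2 (R + t) - Real.logb 2 R))
    (X : Finset ℕ) :
    (∀ x ∈ X, 0 < a x) → (∀ x ∈ X, v + ∑ y ∈ X with φ x < φ y, a y ≤ S x) →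
      M * X.card - K * (Real.logb 2 (v + ∑ x ∈ X, a x) - Real.logb 2 v) ≤
        ∑ x ∈ X, (Real.logb 2 (S x) - Real.logb 2 (a x)) := by
  induction X using Finset.induction_on_min_value φ with
  | empty => simp
  | insert x X hx hmin ih =>
    intro ha hS
    have hlt : ∀ y ∈ X, φ x < φ y := fun y hy =>
      lt_of_le_of_ne (hmin y hy) fun h => hx (hφ h ▸ hy)
    have h1 := ih (fun y hy => ha y (by simp [hy])) (by
      intro y hy
      have := hS y (by simp [hy])
      rwa [Finset.filter_insert, if_neg (hlt y hy).not_gt] at this)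
    have h2 := hS x (by simp)
    rw [Finset.filter_insert, if_neg (lt_irrefl _), Finset.filter_true_of_mem hlt] at h2
    have hR : 0 < v + ∑ y ∈ X, a y :=
      add_pos_of_pos_of_nonneg hv (Finset.sum_nonneg fun y hy => (ha y (by simp [hy])).le)
    have h3 := hK _ _ hR (ha x (by simp))
    have h4 := Real.logb_le_logb_of_le (b := 2) (by norm_num) hR h2
    rw [Finset.sum_insert hx, Finset.sum_insert hx, Finset.card_insert_of_notMem hx,
      add_comm (a x), ← add_assoc]
    push_cast
    linarith

lemma exists_logb_tradeoff (M : ℝ) : ∃ K : ℝ, 0 ≤ K ∧ ∀ R t : ℝ, 0 < R → 0 < t →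
    M ≤ Real.logb 2 R - Real.logb 2 t + K * (Real.logb 2 (R + t) - Real.logb 2 R) := by
  have hδ : (0 : ℝ) < 2 ^ (-M) := by positivity
  have hl : 0 < Real.logb 2 (1 + 2 ^ (-M)) := Real.logb_pos (by norm_num) (by linarith)
  refine ⟨1 + |M| / Real.logb 2 (1 + 2 ^ (-M)), by positivity, fun R t hR ht => ?_⟩
  have hmono : Real.logb 2 R ≤ Real.logb 2 (R + t) :=
    Real.logb_le_logb_of_le (by norm_num) hR (by linarith)
  have hmono' : Real.logb 2 t ≤ Real.logb 2 (R + t) :=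
    Real.logb_le_logb_of_le (by norm_num) ht (by linarith)
  rcases le_total t (2 ^ (-M) * R) with h | h
  · have h1 := Real.logb_le_logb_of_le (b := 2) (by norm_num) ht h
    rw [Real.logb_mul hδ.ne' hR.ne', Real.logb_rpow (by norm_num) (by norm_num)] at h1
    have : 0 ≤ (1 + |M| / Real.logb 2 (1 + 2 ^ (-M))) *
        (Real.logb 2 (R + t) - Real.logb 2 R) :=
      mul_nonneg (by positivity) (by linarith)
    linarith
  · have h1 : Real.logb 2 ((1 + 2 ^ (-M)) * R) ≤ Real.logb 2 (R + t) :=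
      Real.logb_le_logb_of_le (by norm_num) (by positivity) (by linarith)
    rw [Real.logb_mul (by positivity) hR.ne'] at h1
    have h2 : |M| ≤ |M| / Real.logb 2 (1 + 2 ^ (-M)) *
        (Real.logb 2 (R + t) - Real.logb 2 R) := by
      rw [div_mul_eq_mul_div, le_div_iff₀ hl]
      exact mul_le_mul_of_nonneg_left (by linarith) (abs_nonneg _)
    have := le_abs_self M
    linarith

/-- Gain of one side `L` of a search path, given the number of nodes preceding each node as an
index: nodes with a common index modulo `d + 1` dominate each other, and those outside the spine
`U` moreover have disjoint new sets. -/
lemma side_gain {φ : ℕ → ℤ} (hφ : Function.Injective φ) {w : ℕ → ℝ} {N L : Finset ℕ}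
    {A B : ℕ → Finset ℕ} {s d : ℕ} {idx : ℕ → ℕ} {U : ℕ → Prop} [DecidablePred U] {M K : ℝ}
    (hw : ∀ i ∈ N, 0 < w i) (hs : s ∈ N) (hK0 : 0 ≤ K)
    (hK : ∀ R t : ℝ, 0 < R → 0 < t →
      M ≤ Real.logb 2 R - Real.logb 2 t + K * (Real.logb 2 (R + t) - Real.logb 2 R))
    (hAN : ∀ x ∈ L, A x ⊆ N) (hBN : ∀ x ∈ L, B x ⊆ N)
    (hsA : ∀ x ∈ L, s ∈ A x) (hsB : ∀ x ∈ L, s ∉ B x) (hxB : ∀ x ∈ L, x ∈ B x)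
    (hidx : ∀ x ∈ L, ∀ y ∈ L, φ x < φ y → idx x < idx y)
    (hBA : ∀ x ∈ L, ∀ y ∈ L, φ x < φ y → x ∉ B y → B y ⊆ A x)
    (hmem : ∀ x ∈ L, ∀ y ∈ L, φ x < φ y → x ∈ B y → idx y ≤ idx x + d)
    (hdisj : ∀ x ∈ L, ∀ y ∈ L, φ x < φ y → ¬ U x → ¬ U y → ¬ Disjoint (B x) (B y) →
      idx y ≤ idx x + d) :
    M * (L.filter fun x => ¬ U x).card -
        (d + 1) * (K + 1) * (Real.logb 2 (wsum w N) - Real.logb 2 (w s)) ≤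
      ∑ x ∈ L, (Real.logb 2 (wsum w (A x)) - Real.logb 2 (wsum w (B x))) := by
  have hws := hw s hs
  have hmono : ∀ X Y : Finset ℕ, X ⊆ Y → Y ⊆ N → wsum w X ≤ wsum w Y := fun X Y h h' =>
    Finset.sum_le_sum_of_subset_of_nonneg h fun i hi _ => (hw i (h' hi)).le
  have hsingle : ∀ X : Finset ℕ, X ⊆ N → ∀ x ∈ X, w x ≤ wsum w X := fun X h x hx =>
    Finset.single_le_sum (f := w) (fun i hi => (hw i (h hi)).le) hx
  have hBpos : ∀ x ∈ L, 0 < wsum w (B x) := fun x hx =>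
    (hw x (hBN x hx (hxB x hx))).trans_le (hsingle _ (hBN x hx) x (hxB x hx))
  have hsW : w s ≤ wsum w N := hsingle N subset_rfl s hs
  have hLg : 0 ≤ Real.logb 2 (wsum w N) - Real.logb 2 (w s) :=
    sub_nonneg.2 (Real.logb_le_logb_of_le (by norm_num) hws hsW)
  have hgap : ∀ x ∈ L, ∀ y ∈ L, φ x < φ y → idx x % (d + 1) = idx y % (d + 1) →
      ¬ idx y ≤ idx x + d := by
    intro x hx y hy hxy hmod hle
    have hlt := hidx x hx y hy hxy
    have hdvd : d + 1 ∣ idx y - idx x := (Nat.modEq_iff_dvd' hlt.le).1 hmod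
    have := Nat.le_of_dvd (by omega) hdvd
    omega
  have hweak : ∀ X ⊆ L, (∀ x ∈ X, ∀ y ∈ X, idx x % (d + 1) = idx y % (d + 1)) →
      -(Real.logb 2 (wsum w N) - Real.logb 2 (w s)) ≤
        ∑ x ∈ X, (Real.logb 2 (wsum w (A x)) - Real.logb 2 (wsum w (B x))) := by
    intro X hX hcol
    have := sum_logb_sub_ge_of_chain hφ (S := fun x => wsum w (A x))
      (a := fun x => wsum w (B x)) hws X (wsum w N) hsW (fun x hx => hBpos x (hX hx))
      (fun x hx => hmono _ _ (hBN x (hX hx)) subset_rfl)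
      (fun x hx => hsingle _ (hAN x (hX hx)) s (hsA x (hX hx)))
      (fun x hx y hy hxy => hmono _ _ (hBA x (hX hx) y (hX hy) hxy fun h =>
        hgap x (hX hx) y (hX hy) hxy (hcol x hx y hy) (hmem x (hX hx) y (hX hy) hxy h))
        (hAN x (hX hx)))
    linarith
  have hadd : ∀ X ⊆ L, ∀ Y : Finset ℕ, (∀ x ∈ X, ∀ y ∈ X, x ≠ y → Disjoint (B x) (B y)) →
      (∀ x ∈ X, B x ⊆ Y) → s ∈ Y → Y ⊆ N → w s + ∑ x ∈ X, wsum w (B x) ≤ wsum w Y := by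
    intro X hX Y hd hXY hsY hYN
    have hsX : s ∉ X.biUnion B := by
      simp only [Finset.mem_biUnion, not_exists, not_and]
      exact fun x hx => hsB x (hX hx)
    have : wsum w (insert s (X.biUnion B)) = w s + ∑ x ∈ X, wsum w (B x) := by
      unfold wsum
      rw [Finset.sum_insert hsX, Finset.sum_biUnion hd]
    rw [← this]
    exact hmono _ _ (Finset.insert_subset hsY (Finset.biUnion_subset.2 hXY)) hYN
  have hstrong : ∀ X ⊆ L, (∀ x ∈ X, ¬ U x) →
      (∀ x ∈ X, ∀ y ∈ X, idx x % (d + 1) = idx y % (d + 1)) →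
      M * X.card - K * (Real.logb 2 (wsum w N) - Real.logb 2 (w s)) ≤
        ∑ x ∈ X, (Real.logb 2 (wsum w (A x)) - Real.logb 2 (wsum w (B x))) := by
    intro X hX hU hcol
    have hlt : ∀ x ∈ X, ∀ y ∈ X, φ x < φ y → Disjoint (B x) (B y) := fun x hx y hy hxy => by
      by_contra h
      exact hgap x (hX hx) y (hX hy) hxy (hcol x hx y hy)
        (hdisj x (hX hx) y (hX hy) hxy (hU x hx) (hU y hy) h)
    have hd : ∀ x ∈ X, ∀ y ∈ X, x ≠ y → Disjoint (B x) (B y) := fun x hx y hy hxy =>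
      (lt_or_gt_of_ne (hφ.ne hxy)).elim (hlt x hx y hy) fun h => (hlt y hy x hx h).symm
    have h1 := sum_logb_sub_ge_of_disjoint hφ (S := fun x => wsum w (A x))
      (a := fun x => wsum w (B x)) hws hK X (fun x hx => hBpos x (hX hx)) (by
        intro x hx
        refine hadd _ ((Finset.filter_subset _ _).trans hX) (A x) ?_ ?_ (hsA x (hX hx))
          (hAN x (hX hx))
        · exact fun y hy z hz => hd y (Finset.mem_filter.1 hy).1 z (Finset.mem_filter.1 hz).1
        · intro y hy
          obtain ⟨hy, hxy⟩ := Finset.mem_filter.1 hy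
          exact hBA x (hX hx) y (hX hy) hxy fun h =>
            Finset.disjoint_left.1 (hlt x hx y hy hxy) (hxB x (hX hx)) h)
    have h2 := hadd X hX N hd (fun x hx => hBN x (hX hx)) hs subset_rfl
    have h3 : Real.logb 2 (w s + ∑ x ∈ X, wsum w (B x)) ≤ Real.logb 2 (wsum w N) :=
      Real.logb_le_logb_of_le (by norm_num)
        (add_pos_of_pos_of_nonneg hws (Finset.sum_nonneg fun x hx => (hBpos x (hX hx)).le)) h2
    have := mul_le_mul_of_nonneg_left (sub_le_sub_right h3 (Real.logb 2 (w s))) hK0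
    linarith
  have hmaps : ∀ X ⊆ L, ∀ x ∈ X, idx x % (d + 1) ∈ Finset.range (d + 1) := fun _ _ x _ =>
    Finset.mem_range.2 (Nat.mod_lt _ (Nat.succ_pos d))
  have hcard := Finset.card_eq_sum_card_fiberwise
    (hmaps (L.filter fun x => ¬ U x) (Finset.filter_subset _ _))
  rw [← Finset.sum_fiberwise_of_maps_to (hmaps L subset_rfl), hcard]
  have hclass : ∀ j ∈ Finset.range (d + 1),
      M * (((L.filter fun x => ¬ U x).filter fun x => idx x % (d + 1) = j).card : ℝ) -
          (K + 1) * (Real.logb 2 (wsum w N) - Real.logb 2 (w s)) ≤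
        ∑ x ∈ L with idx x % (d + 1) = j,
          (Real.logb 2 (wsum w (A x)) - Real.logb 2 (wsum w (B x))) := by
    intro j _
    rw [← Finset.sum_filter_add_sum_filter_not _ U, Finset.filter_comm]
    have h1 := hweak ((L.filter fun x => idx x % (d + 1) = j).filter U)
      ((Finset.filter_subset _ _).trans (Finset.filter_subset _ _))
      (by simp only [Finset.mem_filter]; grind)
    have h2 := hstrong ((L.filter fun x => idx x % (d + 1) = j).filter fun x => ¬ U x)
      ((Finset.filter_subset _ _).trans (Finset.filter_subset _ _))
      (by simp only [Finset.mem_filter]; grind) (by simp only [Finset.mem_filter]; grind)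
    linarith
  refine le_trans (le_of_eq ?_) (Finset.sum_le_sum hclass)
  rw [Finset.sum_sub_distrib, ← Finset.mul_sum, Finset.sum_const, Finset.card_range, nsmul_eq_mul]
  push_cast
  ring

lemma between_of_monotone_or_antitone {φ : ℕ → ℤ} (hφ : StrictMono φ ∨ StrictAnti φ) {p z q : ℕ}
    (h1 : φ p ≤ φ z) (h2 : φ z ≤ φ q) : (p ≤ z ∧ z ≤ q) ∨ (q ≤ z ∧ z ≤ p) := by
  rcases hφ with h | h
  · exact Or.inl ⟨h.le_iff_le.1 h1, h.le_iff_le.1 h2⟩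
  · exact Or.inr ⟨h.le_iff_ge.1 h2, h.le_iff_ge.1 h1⟩

lemma subtreeKeys_convex_of_key {φ : ℕ → ℤ} (hφ : StrictMono φ ∨ StrictAnti φ) {T : BTree}
    (hT : isBST T) {p q z y : ℕ} (hp : p ∈ subtreeKeys T y) (hq : q ∈ subtreeKeys T y)
    (hz : z ∈ keys T) (h1 : φ p ≤ φ z) (h2 : φ z ≤ φ q) : z ∈ subtreeKeys T y := by
  rcases between_of_monotone_or_antitone hφ h1 h2 with h | h
  · exact subtreeKeys_convex hT hp hq hz h.1 h.2
  · exact subtreeKeys_convex hT hq hp hz h.1 h.2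

lemma exists_common_ancestor_of_key {φ : ℕ → ℤ} (hφ : StrictMono φ ∨ StrictAnti φ) {T : BTree}
    (hT : isBST T) {x y : ℕ} (hx : x ∈ keys T) (hy : y ∈ keys T) (hxy : φ x ≤ φ y) :
    ∃ u, φ x ≤ φ u ∧ φ u ≤ φ y ∧ x ∈ subtreeKeys T u ∧ y ∈ subtreeKeys T u := by
  rcases hφ with h | h
  · obtain ⟨u, h1, h2, h3, h4⟩ := exists_common_ancestor hT hx hy (h.le_iff_le.1 hxy)
    exact ⟨u, h.monotone h1, h.monotone h2, h3, h4⟩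
  · obtain ⟨u, h1, h2, h3, h4⟩ := exists_common_ancestor hT hy hx (h.le_iff_ge.1 hxy)
    exact ⟨u, h.antitone h2, h.antitone h1, h4, h3⟩

/-- Gain of one side (selected by the orientation `φ`) of the search path of an access. -/
lemma IsAccess.side_gain {T T' : BTree} {s : ℕ} (h : IsAccess T s T') {φ : ℕ → ℤ}
    (hφ : StrictMono φ ∨ StrictAnti φ) {e c M K : ℝ} {d : ℕ} {w : ℕ → ℝ}
    (he : e ≤ 1 / 2) (hc : 0 ≤ c) (hM : 0 ≤ M) (hK0 : 0 ≤ K)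
    (hK : ∀ R t : ℝ, 0 < R → 0 < t →
      M ≤ Real.logb 2 R - Real.logb 2 t + K * (Real.logb 2 (R + t) - Real.logb 2 R))
    (hw : ∀ i ∈ keys T, 0 < w i)
    (hloss : ∀ x ∈ pathSet T s, (1 / 2 + e) * (((pathSet T x).card : ℝ) - 1) - c ≤
      (((pathSet T x \ {x}) \ pathSet T' x).card : ℝ))
    (hgain : ∀ y ∈ pathSet T s, y ≠ s →
      ((pathSet T s).filter (fun x => y ∈ pathSet T' x ∧ y ∉ pathSet T x)).card ≤ d) :
    M * (((pathSet T s).filter fun x => φ x < φ s).card -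
          ((1 / 2 - e) * (pathSet T s).card + c + 1)) -
        (d + 1) * (K + 1) * (Real.logb 2 (wsum w (keys T)) - Real.logb 2 (w s)) ≤
      ∑ x ∈ pathSet T s with φ x < φ s,
        (Real.logb 2 (wsum w (subtreeKeys T x)) - Real.logb 2 (wsum w (subtreeKeys T' x))) := by
  obtain ⟨hT, hT', hs, hkeys, hroot, hpend⟩ := h
  have hinj : Function.Injective φ := hφ.elim StrictMono.injective StrictAnti.injective
  set P := pathSet T s
  set L := P.filter fun x => φ x < φ s
  have memP : ∀ {x}, x ∈ P ↔ s ∈ subtreeKeys T x := mem_pathSet_iff hT hs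
  have hPN : ∀ {x}, x ∈ P → x ∈ keys T := fun hx => mem_keys_of_mem_subtreeKeys (memP.1 hx)
  have memL : ∀ {x}, x ∈ L ↔ x ∈ P ∧ φ x < φ s := Finset.mem_filter
  have hBN : ∀ {x}, subtreeKeys T' x ⊆ keys T := by
    intro x
    exact hkeys ▸ subtreeKeys_subset_keys T' x
  have hBself : ∀ {x}, x ∈ keys T → x ∈ subtreeKeys T' x := fun hx =>
    self_mem_subtreeKeys hT' (hkeys.symm ▸ hx)
  have hBs : subtreeKeys T' s = keys T := (subtreeKeys_of_root hroot).trans hkeys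
  have hsB : ∀ {x}, x ∈ L → s ∉ subtreeKeys T' x := by
    intro x hx hsx
    have : x = s := eq_of_mem_subtreeKeys hT' (hBs.symm ▸ hPN (memL.1 hx).1) hsx
    exact (memL.1 hx).2.ne (this ▸ rfl)
  have hconv : ∀ {p q z u}, p ∈ subtreeKeys T' u → q ∈ subtreeKeys T' u → z ∈ keys T →
      φ p ≤ φ z → φ z ≤ φ q → z ∈ subtreeKeys T' u := fun hp hq hz =>
    subtreeKeys_convex_of_key hφ hT' hp hq (hkeys.symm ▸ hz)
  have hAint : ∀ {x z}, x ∈ L → z ∈ keys T → φ x ≤ φ z → φ z ≤ φ s → z ∈ subtreeKeys T x :=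
    fun hx hz => subtreeKeys_convex_of_key hφ hT (self_mem_subtreeKeys hT (hPN (memL.1 hx).1))
      (memP.1 (memL.1 hx).1) hz
  set idx : ℕ → ℕ := fun x => (L.filter fun z => φ z < φ x).card
  have hidx_lt : ∀ {x y}, x ∈ L → φ x < φ y → idx x < idx y := by
    intro x y hx hxy
    refine Finset.card_lt_card ((Finset.ssubset_iff_of_subset ?_).2 ⟨x, ?_, ?_⟩)
    · exact Finset.monotone_filter_right _ fun z _ hz => lt_trans hz hxy
    · simp [hx, hxy]
    · simp
  have hmem : ∀ {x y}, x ∈ L → y ∈ L → φ x < φ y → x ∈ subtreeKeys T' y →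
      idx y ≤ idx x + d := by
    intro x y hx hy hxy hxB
    have hyP := (memL.1 hy).1
    refine le_trans ?_ (Nat.add_le_add_left
      (hgain y hyP fun h => (memL.1 hy).2.ne (h ▸ rfl)) _)
    refine le_trans (Finset.card_le_card ?_) (Finset.card_union_le _ _)
    intro z hz
    obtain ⟨hzL, hzy⟩ := Finset.mem_filter.1 hz
    have hzN := hPN (memL.1 hzL).1
    rw [Finset.mem_union]
    by_cases hzx : φ z < φ x
    · exact Or.inl (Finset.mem_filter.2 ⟨hzL, hzx⟩)
    · refine Or.inr (Finset.mem_filter.2 ⟨(memL.1 hzL).1, ?_, ?_⟩)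
      · rw [mem_pathSet_iff hT' (hkeys.symm ▸ hzN)]
        exact hconv hxB (hBself (hPN hyP)) hzN (not_lt.1 hzx) hzy.le
      · rw [mem_pathSet_iff hT hzN]
        intro hzA
        have := eq_of_mem_subtreeKeys hT hzA (hAint hzL (hPN hyP) hzy.le (memL.1 hy).2.le)
        exact hzy.ne (this ▸ rfl)
  rcases L.eq_empty_or_nonempty with hempty | hne
  · have hLg : 0 ≤ Real.logb 2 (wsum w (keys T)) - Real.logb 2 (w s) :=
      sub_nonneg.2 (Real.logb_le_logb_of_le (by norm_num) (hw s hs)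
        (Finset.single_le_sum (f := w) (fun i hi => (hw i hi).le) hs))
    rw [hempty]
    simp only [Finset.card_empty, Finset.sum_empty, Nat.cast_zero, zero_sub]
    have h1 : 0 ≤ M * ((1 / 2 - e) * (P.card : ℝ) + c + 1) := by
      have : 0 ≤ 1 / 2 - e := by linarith
      positivity
    have h2 : 0 ≤ (d + 1) * (K + 1) * (Real.logb 2 (wsum w (keys T)) - Real.logb 2 (w s)) := by
      positivity
    linarith
  obtain ⟨m, hmL, hmax⟩ := L.exists_max_image φ hne
  have hmP := (memL.1 hmL).1
  have hmN := hPN hmP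
  have hspine : ((L.filter fun x => m ∈ subtreeKeys T' x).card : ℝ) ≤
      (1 / 2 - e) * P.card + c + 1 := by
    have hsub : L.filter (fun x => m ∈ subtreeKeys T' x) ∪
        ((pathSet T m \ {m}) \ pathSet T' m) ⊆ pathSet T m := by
      refine Finset.union_subset (fun x hx => ?_)
        (Finset.sdiff_subset.trans Finset.sdiff_subset)
      have hx := (Finset.mem_filter.1 hx).1
      rw [mem_pathSet_iff hT hmN]
      exact hAint hx hmN (hmax x hx) (memL.1 hmL).2.le
    have hdis : Disjoint (L.filter fun x => m ∈ subtreeKeys T' x)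
        ((pathSet T m \ {m}) \ pathSet T' m) := by
      rw [Finset.disjoint_left]
      intro x hx hx'
      exact (Finset.mem_sdiff.1 hx').2
        ((mem_pathSet_iff hT' (hkeys.symm ▸ hmN)).2 (Finset.mem_filter.1 hx).2)
    have h1 := Finset.card_le_card hsub
    rw [Finset.card_union_of_disjoint hdis] at h1
    have h2 : pathSet T m ⊆ P := fun x hx => memP.2
      (subtreeKeys_subset_of_mem hT ((mem_pathSet_iff hT hmN).1 hx) (memP.1 hmP))
    have h2 := Finset.card_le_card h2
    have h3 := hloss m hmP
    have h1' : (((L.filter fun x => m ∈ subtreeKeys T' x).card : ℝ) +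
      (((pathSet T m \ {m}) \ pathSet T' m).card : ℝ)) ≤ (pathSet T m).card := by
      exact_mod_cast h1
    have h2' : ((pathSet T m).card : ℝ) ≤ P.card := by exact_mod_cast h2
    nlinarith
  have hcore := Paper.side_gain hinj (w := w) (N := keys T) (L := L) (A := subtreeKeys T)
    (B := subtreeKeys T') (s := s) (d := d) (idx := idx)
    (U := fun x => m ∈ subtreeKeys T' x) hw hs hK0 hK
    (fun x _ => subtreeKeys_subset_keys T x) (fun x _ => hBN) (fun x hx => memP.1 (memL.1 hx).1)
    (fun x hx => hsB hx) (fun x hx => hBself (hPN (memL.1 hx).1))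
    (fun x hx y _ hxy => hidx_lt hx hxy)
    (by
      intro x hx y hy hxy hxB z hz
      refine hAint hx (hBN hz) ?_ ?_
      · by_contra! hzx
        exact hxB (hconv hz (hBself (hPN (memL.1 hy).1)) (hPN (memL.1 hx).1) hzx.le hxy.le)
      · by_contra! hsz
        exact hsB hy (hconv (hBself (hPN (memL.1 hy).1)) hz hs (memL.1 hy).2.le hsz.le))
    (fun x hx y hy hxy hxB => hmem hx hy hxy hxB)
    (by
      intro x hx y hy hxy hUx _ hnd
      obtain ⟨z, hzx, hzy⟩ := Finset.not_disjoint_iff.1 hnd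
      rcases mem_subtreeKeys_or hT' hzx hzy with hxBy | hyBx
      · exact hmem hx hy hxy hxBy
      obtain ⟨u, hxu, hum, hxBu, hmBu⟩ := exists_common_ancestor_of_key hφ hT'
        (hkeys.symm ▸ hPN (memL.1 hx).1) (hkeys.symm ▸ hmN) (hmax x hx)
      have huN : u ∈ keys T := hkeys ▸ mem_keys_of_mem_subtreeKeys hxBu
      have hux : u ≠ x := fun h => hUx (h ▸ hmBu)
      have huP : u ∈ P := by
        by_contra huP
        have heq : subtreeKeys T' u = subtreeKeys T u := by
          simp only [subtreeKeys, hpend u huN huP]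
        exact huP (memP.2 (subtreeKeys_subset_of_mem hT (heq ▸ hxBu) (memP.1 (memL.1 hx).1)))
      have huL : u ∈ L := memL.2 ⟨huP, hum.trans_lt (memL.1 hmL).2⟩
      have huBx : u ∉ subtreeKeys T' x := fun h => hux (eq_of_mem_subtreeKeys hT' h hxBu)
      have hyu : φ y < φ u := by
        by_contra! huy
        exact huBx (hconv (hBself (hPN (memL.1 hx).1)) hyBx huN hxu huy)
      exact (hidx_lt hy hyu).le.trans (hmem hx huL (hxy.trans hyu) hxBu))
  have hsplit : (L.card : ℝ) = (L.filter fun x => m ∈ subtreeKeys T' x).card +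
      (L.filter fun x => ¬ m ∈ subtreeKeys T' x).card := by
    exact_mod_cast (Finset.card_filter_add_card_filter_not _).symm
  have := mul_le_mul_of_nonneg_left (show (L.card : ℝ) - ((1 / 2 - e) * P.card + c + 1) ≤
    (L.filter fun x => ¬ m ∈ subtreeKeys T' x).card by linarith) hM
  linarith

end Paper

/-- **Theorem (strict depth-halving).** If in every access of `Alg` every node `x` of the
search path loses at least `(1/2 + ε)·d(x) − c` ancestors and every node other than the
accessed element gains at most `d` new descendants (among path nodes), then `Alg`
satisfies the access lemma via the SOL potential. -/
theorem depth_halving_theorem (Alg : BTree → ℕ → BTree → Prop)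
    (hvalid : ∀ T s T', Alg T s T' → IsAccess T s T')
    (ε c : ℝ) (hε : 0 < ε) (hc : 0 < c) (d : ℕ) (hd : 0 < d)
    (hloss : ∀ T s T', Alg T s T' → ∀ x ∈ pathSet T s,
      (1 / 2 + ε) * (((pathSet T x).card : ℝ) - 1) - c ≤
        (((pathSet T x \ {x}) \ pathSet T' x).card : ℝ))
    (hgain : ∀ T s T', Alg T s T' → ∀ y ∈ pathSet T s, y ≠ s →
      ((pathSet T s).filter (fun x => y ∈ pathSet T' x ∧ y ∉ pathSet T x)).card ≤ d) :
    SatisfiesAL Alg := by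
  set e := min ε (1 / 2)
  have he0 : 0 < e := lt_min hε (by norm_num)
  obtain ⟨K, hK0, hK⟩ := exists_logb_tradeoff (1 / (2 * e))
  refine ⟨1 / (2 * e) * (2 * c + 3) + (2 * ((d + 1) * (K + 1)) + 1), by positivity, ?_⟩
  intro T s T' hA w hw
  have hacc := hvalid T s T' hA
  have hws := hw s hacc.hs
  have hloss' : ∀ x ∈ pathSet T s, (1 / 2 + e) * (((pathSet T x).card : ℝ) - 1) - c ≤
      (((pathSet T x \ {x}) \ pathSet T' x).card : ℝ) := by
    intro x hx
    refine le_trans ?_ (hloss T s T' hA x hx)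
    have hxk := mem_keys_of_mem_subtreeKeys ((mem_pathSet_iff hacc.hT hacc.hs).1 hx)
    have h1 : 1 ≤ (pathSet T x).card := Finset.card_pos.2
      ⟨x, (mem_pathSet_iff hacc.hT hxk).2 (self_mem_subtreeKeys hacc.hT hxk)⟩
    have h1' : (1 : ℝ) ≤ (pathSet T x).card := by exact_mod_cast h1
    have h2 : e ≤ ε := min_le_left _ _
    nlinarith
  have hside := fun (φ : ℕ → ℤ) (hφ : StrictMono φ ∨ StrictAnti φ) =>
    hacc.side_gain hφ (min_le_right ε (1 / 2)) hc.le (by positivity) hK0 hK hw hloss'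
      (hgain T s T' hA)
  have hl := hside (fun x => x) (Or.inl fun a b h => by simpa using h)
  have hr := hside (fun x => -x) (Or.inr fun a b h => by simpa using h)
  simp only [Nat.cast_lt, neg_lt_neg_iff] at hl hr
  have hsP : s ∈ pathSet T s :=
    (mem_pathSet_iff hacc.hT hacc.hs).2 (self_mem_subtreeKeys hacc.hT hacc.hs)
  have hPk : pathSet T s ⊆ keys T := fun x hx =>
    mem_keys_of_mem_subtreeKeys ((mem_pathSet_iff hacc.hT hacc.hs).1 hx)
  have hdiff : phiAll w T - phiAll w T' = ∑ x ∈ pathSet T s,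
      (Real.logb 2 (wsum w (subtreeKeys T x)) - Real.logb 2 (wsum w (subtreeKeys T' x))) := by
    unfold phiAll phiOn
    rw [hacc.hkeys, ← Finset.sum_sub_distrib]
    refine (Finset.sum_subset hPk fun x hx hxP => ?_).symm
    simp only [subtreeKeys, hacc.hpendent x hx hxP, sub_self]
  have hpart : pathSet T s = insert s (((pathSet T s).filter fun x => x < s) ∪
      (pathSet T s).filter fun x => s < x) := by
    ext x
    simp only [Finset.mem_insert, Finset.mem_union, Finset.mem_filter]
    grind
  have hdis : Disjoint ((pathSet T s).filter fun x => x < s)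
      ((pathSet T s).filter fun x => s < x) := by
    rw [Finset.disjoint_filter]
    intro x _ h
    exact h.not_gt
  have hsn : s ∉ ((pathSet T s).filter fun x => x < s) ∪
      (pathSet T s).filter fun x => s < x := by simp
  have hcard := congrArg Finset.card hpart
  rw [Finset.card_insert_of_notMem hsn, Finset.card_union_of_disjoint hdis] at hcard
  have hcard' : ((pathSet T s).card : ℝ) = ((pathSet T s).filter fun x => x < s).card +
      ((pathSet T s).filter fun x => s < x).card + 1 := by exact_mod_cast hcard
  have hsum := Finset.sum_congr hpart fun x _ => Eq.refl
    (Real.logb 2 (wsum w (subtreeKeys T x)) - Real.logb 2 (wsum w (subtreeKeys T' x)))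
  rw [Finset.sum_insert hsn, Finset.sum_union hdis, subtreeKeys_of_root hacc.hroot,
    hacc.hkeys] at hsum
  have hroot : Real.logb 2 (w s) ≤ Real.logb 2 (wsum w (subtreeKeys T s)) :=
    Real.logb_le_logb_of_le (by norm_num) hws (Finset.single_le_sum (f := w)
      (fun i hi => (hw i (subtreeKeys_subset_keys T s hi)).le)
      (self_mem_subtreeKeys hacc.hT hacc.hs))
  have hsW : w s ≤ wsum w (keys T) :=
    Finset.single_le_sum (f := w) (fun i hi => (hw i hi).le) hacc.hs
  have hLg : 0 ≤ Real.logb 2 (wsum w (keys T)) - Real.logb 2 (w s) :=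
    sub_nonneg.2 (Real.logb_le_logb_of_le (by norm_num) hws hsW)
  rw [hdiff, hsum, Real.logb_div (hws.trans_le hsW).ne' hws.ne']
  set g := Real.logb 2 (wsum w (keys T)) - Real.logb 2 (w s)
  set D : ℝ := (d + 1) * (K + 1)
  have hD0 : 0 ≤ D := by positivity
  have hMpos : 0 ≤ 1 / (2 * e) * (2 * c + 3) := by positivity
  have hkey : 1 / (2 * e) * (((pathSet T s).filter fun x => x < s).card -
        ((1 / 2 - e) * (pathSet T s).card + c + 1)) +
      1 / (2 * e) * (((pathSet T s).filter fun x => s < x).card -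
        ((1 / 2 - e) * (pathSet T s).card + c + 1)) =
      (pathSet T s).card - 1 / (2 * e) * (2 * c + 3) := by
    rw [show (((pathSet T s).filter fun x => s < x).card : ℝ) = (pathSet T s).card - 1 -
      ((pathSet T s).filter fun x => x < s).card by linarith]
    field_simp
    ring
  have := mul_nonneg hMpos hLg
  linarith
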